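/- Let a₁, a₂ > 0 with a₁ ≠ a₂ and let k ≥ 0 be an integer. Define f_{k+1}(ω,a₁,a₂) := (√(2π)/((a₁−a₂)^{2k+1} k!)) ∑_{n=0}^{k} ((2k−n)!/(n!(k−n)!)) (a₁−a₂)^n ω^n [g(ω,a₂) − (−1)^n g(ω,a₁)], where g(ω,a) := e^{aω} · 1_{(−∞,0)}(ω). Then ∫_ℝ |f_{k+1}(ω,a₁,a₂)| dω = √(2π)/(a₁ a₂)^{k+1}. -/

import Mathlib

open MeasureTheory

/-- The indicator-exponential function `g(ω,a) = e^{aω} 1_{(−∞,0)}(ω)`. -/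
noncomputable def gfun (ω a : ℝ) : ℝ :=
  Real.exp (a * ω) * Set.indicator (Set.Iio (0 : ℝ)) (fun _ => (1 : ℝ)) ω

/-- The function `f_{k+1}(·, a₁, a₂)` of Lemma 3.4 of the paper. -/
noncomputable def ffun (k : ℕ) (ω a₁ a₂ : ℝ) : ℝ :=
  Real.sqrt (2 * Real.pi) / ((a₁ - a₂) ^ (2 * k + 1) * (Nat.factorial k)) *
    ∑ n ∈ Finset.range (k + 1),
      ((Nat.factorial (2 * k - n) : ℝ) / (Nat.factorial n * Nat.factorial (k - n))) *
        (a₁ - a₂) ^ n * ω ^ n * (gfun ω a₂ - (-1) ^ n * gfun ω a₁)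

open Polynomial in
lemma aux_int (d : ℝ) (hd : d ≠ 0) (P : ℝ[X]) (N : ℕ) (hN : P.natDegree < N) (b : ℝ) :
    ∫ s in (0 : ℝ)..b, P.eval s * Real.exp (-d * s) =
      ∑ j ∈ Finset.range N, (derivative^[j] P).eval 0 / d ^ (j + 1)
      - Real.exp (-d * b) * ∑ j ∈ Finset.range N, (derivative^[j] P).eval b / d ^ (j + 1) := by
  have key : ∀ s : ℝ, HasDerivAt
      (fun s => -(Real.exp (-d * s) * ∑ j ∈ Finset.range N, (derivative^[j] P).eval s / d ^ (j + 1)))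
      (P.eval s * Real.exp (-d * s)) s := by
    intro s
    have e1 : HasDerivAt (fun s : ℝ => Real.exp (-d * s)) (Real.exp (-d * s) * (-d)) s := by
      have := ((hasDerivAt_id s).const_mul (-d)).exp
      simpa using this
    have e2 : HasDerivAt
        (fun s : ℝ => ∑ j ∈ Finset.range N, (derivative^[j] P).eval s / d ^ (j + 1))
        (∑ j ∈ Finset.range N, (derivative^[j+1] P).eval s / d ^ (j + 1)) s := by
      refine HasDerivAt.fun_sum fun j _ => ?_
      rw [Function.iterate_succ_apply']
      exact (Polynomial.hasDerivAt _ s).div_const _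
    refine (e1.mul e2).neg.congr_deriv ?_
    have h3 := Finset.sum_range_sub' (fun j => (derivative^[j] P).eval s / d ^ j) N
    rw [iterate_derivative_eq_zero hN] at h3
    simp only [Function.iterate_zero, id, pow_zero, div_one, eval_zero, zero_div, sub_zero] at h3
    rw [← h3, Finset.sum_sub_distrib]
    have h4 : ∑ j ∈ Finset.range N, (derivative^[j] P).eval s / d ^ j
        = d * ∑ j ∈ Finset.range N, (derivative^[j] P).eval s / d ^ (j + 1) := by
      rw [Finset.mul_sum]
      refine Finset.sum_congr rfl fun j _ => ?_
      field_simp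
      ring
    rw [h4]
    ring
  rw [intervalIntegral.integral_eq_sub_of_hasDerivAt (fun s _ => key s)
    (by apply Continuous.intervalIntegrable; fun_prop)]
  simp
  ring

open Polynomial in
lemma aux_comp (P : ℝ[X]) (t : ℝ) (j : ℕ) :
    derivative^[j] (P.comp (C t - X)) = (-1) ^ j * (derivative^[j] P).comp (C t - X) := by
  induction j with
  | zero => simp
  | succ j ih =>
    rw [Function.iterate_succ_apply', ih, Function.iterate_succ_apply']
    have : ((-1 : ℝ[X]) ^ j) = C ((-1) ^ j) := by simp
    rw [this, derivative_C_mul, derivative_comp]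
    simp [pow_succ]

open Polynomial in
lemma aux_sum (d : ℝ) (hd : d ≠ 0) (k : ℕ) (w : ℝ) :
    ∫ s in (0 : ℝ)..(-w), (s ^ k * (s + w) ^ k) * Real.exp (-d * s) =
      ∑ n ∈ Finset.range (k + 1), ((2 * k - n).factorial : ℝ) * (k.choose n) * w ^ n * d ^ n
        / d ^ (2 * k + 1) * (1 - (-1) ^ n * Real.exp (d * w)) := by
  set P : ℝ[X] := X ^ k * (X + C w) ^ k with hP
  have hdeg : P.natDegree < k + 1 + k := by
    have : P.natDegree = k + k := by
      rw [hP, Polynomial.Monic.natDegree_mul (monic_X_pow k) ((monic_X_add_C w).pow k)]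
      simp
    omega
  have hcomp : P.comp (C (-w) - X) = P := by
    have : P.comp (C (-w) - X) = (-X + -C w) ^ k * (-X) ^ k := by
      simp [hP]
      ring
    rw [this, hP, ← neg_add, neg_pow, neg_pow (X : ℝ[X])]
    have h1 : ((-1 : ℝ[X]) ^ k) * (-1) ^ k = 1 := by rw [← mul_pow]; simp
    linear_combination ((X + C w) ^ k * X ^ k) * h1
  have h0 : ∀ j, (derivative^[j] P).eval 0 =
      if k ≤ j then (j.factorial : ℝ) * (w ^ (k - (j - k)) * (k.choose (j - k))) else 0 := by
    intro j
    rw [← coeff_zero_eq_eval_zero, coeff_iterate_derivative, hP, coeff_X_pow_mul',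
      coeff_X_add_C_pow]
    simp [Nat.descFactorial_self]
  have hb : ∀ j, (derivative^[j] P).eval (-w) = (-1) ^ j * (derivative^[j] P).eval 0 := by
    intro j
    conv_lhs => rw [← hcomp, aux_comp]
    simp [eval_comp]
  have hA := aux_int d hd P _ hdeg (-w)
  have : ∀ s : ℝ, P.eval s = s ^ k * (s + w) ^ k := by intro s; simp [hP]
  simp_rw [this] at hA
  rw [hA]
  simp_rw [hb]
  rw [Finset.mul_sum, ← Finset.sum_sub_distrib, ← Finset.sum_range_reflect, Finset.sum_range_add]
  rw [Finset.sum_eq_zero (s := Finset.range k), add_zero]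
  · refine Finset.sum_congr rfl fun n hn => ?_
    have hn : n ≤ k := by simpa [Nat.lt_succ_iff] using hn
    have e1 : k + 1 + k - 1 - n = 2 * k - n := by omega
    rw [e1, h0, if_pos (by omega)]
    have e2 : 2 * k - n - k = k - n := by omega
    have e3 : k - (k - n) = n := by omega
    have e4 : d ^ (2 * k + 1) = d ^ (2 * k - n + 1) * d ^ n := by
      rw [← pow_add]; congr 1; omega
    have e5 : (-1 : ℝ) ^ (2 * k - n) = (-1) ^ n := by
      have : (-1 : ℝ) ^ (2 * k - n) * (-1) ^ n = 1 := by
        rw [← pow_add, show 2 * k - n + n = 2 * k by omega, pow_mul]; simp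
      have h2 : ((-1 : ℝ) ^ n) * (-1) ^ n = 1 := by rw [← mul_pow]; simp
      linear_combination ((-1 : ℝ) ^ n) * this - ((-1 : ℝ) ^ (2 * k - n)) * h2
    rw [e2, e3, Nat.choose_symm hn, e4, e5, show -d * -w = d * w by ring]
    field_simp
  · intro n hn
    have hn : n < k := by simpa using hn
    rw [h0, if_neg (by omega)]
    simp

lemma aux_gamma (k : ℕ) (a : ℝ) (ha : 0 < a) :
    IntegrableOn (fun t : ℝ => t ^ k * Real.exp (-(a * t))) (Set.Ioi 0) ∧
    ∫ t in Set.Ioi (0 : ℝ), t ^ k * Real.exp (-(a * t)) = k.factorial / a ^ (k + 1) := by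
  have h : ∫ t in Set.Ioi (0 : ℝ), t ^ k * Real.exp (-(a * t)) = k.factorial / a ^ (k + 1) := by
    have := Real.integral_rpow_mul_exp_neg_mul_Ioi (a := (k : ℝ) + 1) (by positivity) ha
    rw [Real.Gamma_nat_eq_factorial] at this
    simp only [add_sub_cancel_right, Real.rpow_natCast] at this
    rw [this]
    have : (k : ℝ) + 1 = ((k + 1 : ℕ) : ℝ) := by push_cast; ring
    rw [this, Real.rpow_natCast, one_div, inv_pow]
    field_simp
  exact ⟨.of_integral_ne_zero (by rw [h]; positivity), h⟩

lemma aux_ffun (k : ℕ) (a₁ a₂ : ℝ) (hne : a₁ ≠ a₂) (t : ℝ) (ht : 0 < t) :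
    |ffun k (-t) a₁ a₂| = Real.sqrt (2 * Real.pi) / (k.factorial : ℝ) ^ 2 *
      ∫ s in (0 : ℝ)..t, (s ^ k * Real.exp (-(a₁ * s))) *
        ((t - s) ^ k * Real.exp (-(a₂ * (t - s)))) := by
  have hd : a₁ - a₂ ≠ 0 := sub_ne_zero.mpr hne
  have hI : ∫ s in (0 : ℝ)..t, (s ^ k * Real.exp (-(a₁ * s))) *
        ((t - s) ^ k * Real.exp (-(a₂ * (t - s)))) =
      (-1) ^ k * Real.exp (-(a₂ * t)) *
        ∫ s in (0 : ℝ)..(-(-t)), (s ^ k * (s + -t) ^ k) * Real.exp (-(a₁ - a₂) * s) := by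
    rw [neg_neg, ← intervalIntegral.integral_const_mul]
    refine intervalIntegral.integral_congr fun s _ => ?_
    have e1 : (t - s) ^ k = (-1) ^ k * (s + -t) ^ k := by rw [← mul_pow]; ring
    have e2 : Real.exp (-(a₁ * s)) * Real.exp (-(a₂ * (t - s)))
        = Real.exp (-(a₂ * t)) * Real.exp (-(a₁ - a₂) * s) := by
      rw [← Real.exp_add, ← Real.exp_add]; ring_nf
    simp only [e1]
    linear_combination (s ^ k * ((-1) ^ k * (s + -t) ^ k)) * e2
  have hnn : 0 ≤ ∫ s in (0 : ℝ)..t, (s ^ k * Real.exp (-(a₁ * s))) *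
        ((t - s) ^ k * Real.exp (-(a₂ * (t - s)))) := by
    refine intervalIntegral.integral_nonneg ht.le fun s hs => ?_
    have := hs.1
    have := sub_nonneg.mpr hs.2
    positivity
  have hF : ffun k (-t) a₁ a₂ = (-1) ^ k * (Real.sqrt (2 * Real.pi) / (k.factorial : ℝ) ^ 2 *
      ∫ s in (0 : ℝ)..t, (s ^ k * Real.exp (-(a₁ * s))) *
        ((t - s) ^ k * Real.exp (-(a₂ * (t - s))))) := by
    rw [hI, aux_sum _ hd]
    have h1 : ((-1 : ℝ) ^ k) * (-1) ^ k = 1 := by rw [← mul_pow]; simp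
    have hre : ∀ A B S : ℝ, (-1 : ℝ) ^ k * (A * ((-1) ^ k * B * S)) = A * (B * S) := by
      intro A B S; linear_combination (A * (B * S)) * h1
    rw [hre, ffun, Finset.mul_sum, Finset.mul_sum, Finset.mul_sum]
    refine Finset.sum_congr rfl fun n hn => ?_
    have hn : n ≤ k := by simpa [Nat.lt_succ_iff] using hn
    have g : ∀ a, gfun (-t) a = Real.exp (-(a * t)) := by
      intro a
      simp [gfun, ht]
    have e2 : Real.exp (-(a₁ * t)) = Real.exp (-(a₂ * t)) * Real.exp ((a₁ - a₂) * -t) := by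
      rw [← Real.exp_add]; ring_nf
    rw [g, g, e2, Nat.cast_choose ℝ hn]
    have := Nat.factorial_ne_zero k
    have := Nat.factorial_ne_zero n
    have := Nat.factorial_ne_zero (k - n)
    field_simp
  rw [hF, abs_mul, abs_pow, abs_neg, abs_one, one_pow, one_mul, abs_of_nonneg]
  positivity

/-- Lemma 3.5 of the paper: the `L¹`-norm of `f_{k+1}(·,a₁,a₂)` equals
`√(2π)/(a₁a₂)^{k+1}`. -/
theorem stmt5 (a₁ a₂ : ℝ) (h1 : 0 < a₁) (h2 : 0 < a₂) (hne : a₁ ≠ a₂) (k : ℕ) :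
    (∫ ω : ℝ, |ffun k ω a₁ a₂|) = Real.sqrt (2 * Real.pi) / (a₁ * a₂) ^ (k + 1) := by
  have hz : ∀ w : ℝ, w ∉ Set.Iio (0 : ℝ) → |ffun k w a₁ a₂| = 0 := by
    intro w hw
    simp [ffun, gfun, Set.indicator_of_notMem hw]
  rw [← setIntegral_eq_integral_of_forall_compl_eq_zero hz, ← integral_Iic_eq_integral_Iio]
  have := integral_comp_neg_Ioi (0 : ℝ) (fun w => |ffun k w a₁ a₂|)
  rw [neg_zero] at this
  rw [← this, setIntegral_congr_fun measurableSet_Ioi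
    (fun t ht => aux_ffun k a₁ a₂ hne t ht), integral_const_mul]
  obtain ⟨i1, v1⟩ := aux_gamma k a₁ h1
  obtain ⟨i2, v2⟩ := aux_gamma k a₂ h2
  have hc := integral_posConvolution i1 i2 (ContinuousLinearMap.mul ℝ ℝ)
  simp only [ContinuousLinearMap.mul_apply'] at hc
  rw [hc, v1, v2]
  have := Nat.factorial_ne_zero k
  rw [mul_pow]
  field_simp
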